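/- arXiv:1809.06655 — 3 statements merged into one kernel-verified Lean document; each statement's English description precedes it below -/
import Mathlib

section
/- Deterministic advantage region: for every real p with (√5 − 1)/2 < p < 1, the coherent information of the switched channels exceeds the quantum capacity of each individual flip channel, i.e. 1 + H₂(p²) − 2·H₂(p) > 1 − H₂(p); equivalently, H₂(p²) > H₂(p) for all p in this range. -/
noncomputable section

/-- The binary entropy function (in bits). -/
def H2 (x : ℝ) : ℝ := -x * Real.logb 2 x - (1 - x) * Real.logb 2 (1 - x)

open Real Set in
lemma hasDerivAt_binEntropy_sq_sub {x : ℝ} (h0 : 0 < x) (h1 : x < 1) :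
    HasDerivAt (fun y => binEntropy (y ^ 2) - binEntropy y)
      ((log (1 - x ^ 2) - log (x ^ 2)) * (2 * x) - (log (1 - x) - log x)) x := by
  have hs : x ^ 2 < 1 := by nlinarith
  have h := hasDerivAt_binEntropy (p := x ^ 2) (by positivity) hs.ne
  have hsq : HasDerivAt (fun y : ℝ => y ^ 2) (2 * x) x := by simpa using hasDerivAt_pow 2 x
  exact (HasDerivAt.comp (h := fun y : ℝ => y ^ 2) x h hsq).sub (hasDerivAt_binEntropy h0.ne' h1.ne)

open Real in
lemma hasDerivAt_deriv_binEntropy {x : ℝ} (h0 : 0 < x) (h1 : x < 1) :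
    HasDerivAt (fun y => log (1 - y) - log y) (-1 / (1 - x) - x⁻¹) x :=
  (((hasDerivAt_id x).const_sub 1).log (sub_pos.2 h1).ne').sub (hasDerivAt_log h0.ne')

open Real in
lemma deriv2_binEntropy_sq_sub {x : ℝ} (h0 : 0 < x) (h1 : x < 1) :
    deriv^[2] (fun y => binEntropy (y ^ 2) - binEntropy y) x =
      2 * (log (1 - x ^ 2) - log (x ^ 2)) - (3 * x - 1) / (x * (1 - x ^ 2)) := by
  have hs : x ^ 2 < 1 := by nlinarith
  have hev : deriv (fun y => binEntropy (y ^ 2) - binEntropy y) =ᶠ[nhds x]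
      fun y => (log (1 - y ^ 2) - log (y ^ 2)) * (2 * y) - (log (1 - y) - log y) := by
    filter_upwards [Ioo_mem_nhds h0 h1] with y hy
    exact (hasDerivAt_binEntropy_sq_sub hy.1 hy.2).deriv
  have hsq : HasDerivAt (fun y : ℝ => y ^ 2) (2 * x) x := by simpa using hasDerivAt_pow 2 x
  have hlin : HasDerivAt (fun y : ℝ => 2 * y) 2 x := by
    simpa using (hasDerivAt_id x).const_mul (2 : ℝ)
  have h := ((HasDerivAt.comp (h := fun y : ℝ => y ^ 2) x
    (hasDerivAt_deriv_binEntropy (pow_pos h0 2) hs) hsq).mul hlin).sub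
    (hasDerivAt_deriv_binEntropy h0 h1)
  have hd := hev.deriv_eq.trans h.deriv
  refine hd.trans ?_
  have e1 : 1 - x ≠ 0 := (sub_pos.2 h1).ne'
  have e2 : 1 + x ≠ 0 := by positivity
  have e3 : 1 - x ^ 2 = (1 - x) * (1 + x) := by ring
  simp only [Function.comp]
  generalize log (1 - x ^ 2) - log (x ^ 2) = L
  rw [e3]
  field_simp
  ring

open Real Set in
lemma strictConcaveOn_binEntropy_sq_sub :
    StrictConcaveOn ℝ (Icc ((√5 - 1) / 2) 1) fun y => binEntropy (y ^ 2) - binEntropy y := by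
  refine strictConcaveOn_of_deriv2_neg (convex_Icc _ _) (by fun_prop) fun x hx => ?_
  rw [interior_Icc] at hx
  have h5 : (2.236 : ℝ) < √5 := Real.lt_sqrt_of_sq_lt (by norm_num)
  have hlo : 0.618 < x := by linarith [hx.1]
  have h1 : x < 1 := hx.2
  have h0 : 0 < x := by linarith
  have hs : 0 < 1 - x ^ 2 := by nlinarith
  rw [deriv2_binEntropy_sq_sub h0 h1, ← log_div hs.ne' (by positivity)]
  have hlog := log_le_sub_one_of_pos (div_pos hs (pow_pos h0 2))
  have hpoly : 2 * (1 - 2 * x ^ 2) * (1 - x ^ 2) - x * (3 * x - 1) < 0 := by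
    have : 0.38 < x ^ 2 := by nlinarith
    nlinarith [mul_pos (sub_pos.2 this) hs, mul_pos (sub_pos.2 hlo) (sub_pos.2 h1)]
  have hkey : 2 * ((1 - x ^ 2) / x ^ 2 - 1) - (3 * x - 1) / (x * (1 - x ^ 2)) =
      (2 * (1 - 2 * x ^ 2) * (1 - x ^ 2) - x * (3 * x - 1)) / (x ^ 2 * (1 - x ^ 2)) := by
    field_simp
    ring
  have := div_neg_of_neg_of_pos hpoly (mul_pos (pow_pos h0 2) hs)
  linarith

open Real Set in
/-- At the inverse golden ratio `a`, the identity `a ^ 2 = 1 - a` makes both entropies agree. -/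
lemma binEntropy_lt_binEntropy_sq {p : ℝ} (h₁ : (√5 - 1) / 2 < p) (h₂ : p < 1) :
    binEntropy p < binEntropy (p ^ 2) := by
  set a := (√5 - 1) / 2 with ha
  have hsq : a ^ 2 = 1 - a := by
    rw [ha]
    nlinarith [Real.sq_sqrt (show (0 : ℝ) ≤ 5 by norm_num)]
  have hlt : a < 1 := h₁.trans h₂
  have h := strictConcaveOn_binEntropy_sq_sub.lt_on_openSegment (left_mem_Icc.2 hlt.le)
    (right_mem_Icc.2 hlt.le) hlt.ne (z := p) (by rw [openSegment_eq_Ioo hlt]; exact ⟨h₁, h₂⟩)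
  rw [← ha] at h
  simpa [hsq] using h

lemma H2_eq_binEntropy_div_log_two (x : ℝ) : H2 x = Real.binEntropy x / Real.log 2 := by
  rw [H2, Real.binEntropy_eq_negMulLog_add_negMulLog_one_sub, Real.negMulLog, Real.negMulLog,
    Real.logb, Real.logb]
  ring

/-- Deterministic advantage region: for `(√5 - 1)/2 < p < 1`, the coherent information
`1 + H₂(p²) - 2 H₂(p)` of the switched channels exceeds the quantum capacity
`1 - H₂(p)` of each individual flip channel. -/
theorem switch_deterministic_advantage (p : ℝ)
    (h₁ : (Real.sqrt 5 - 1) / 2 < p) (h₂ : p < 1) :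
    1 + H2 (p ^ 2) - 2 * H2 p > 1 - H2 p := by
  have h := div_lt_div_of_pos_right (binEntropy_lt_binEntropy_sq h₁ h₂)
    (Real.log_pos one_lt_two)
  rw [← H2_eq_binEntropy_div_log_two, ← H2_eq_binEntropy_div_log_two] at h
  linarith

end
end

section
/- No error filtration for independent random unitaries (Proposition 1): let V, W, S, T be n×n complex unitary matrices such that the set {V, W, S} is linearly independent and the pair {S, T} is linearly independent. Let p_V, p_W, q_S, q_T be real numbers with p_V > 0, p_W > 0, q_S > 0, q_T > 0, p_V + p_W = 1, q_S + q_T = 1. Then there do not exist complex numbers α₀, α₁, β₀, β₁, an n×n unitary matrix U, and a real constant c > 0 such that for every n×n complex matrix ρ one has Σ_{U₀∈{V,W}} Σ_{U₁∈{S,T}} p_{U₀} q_{U₁} · A_{U₀,U₁} ρ A_{U₀,U₁}† = c·UρU†, where A_{U₀,U₁} = α₀·conj(β₀)·U₀ + α₁·conj(β₁)·U₁. -/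
open Matrix

noncomputable section

open ComplexConjugate in
/-- If a completely positive map given by positively weighted Kraus operators `A k` equals
`ρ ↦ c U ρ Uᴴ` with `U ≠ 0`, then every `A k` is a multiple of `U`. -/
theorem exists_eq_smul_of_sum_kraus_eq {κ m : Type*} [Fintype κ] [Fintype m] [DecidableEq m]
    (w : κ → ℝ) (hw : ∀ k, 0 < w k) (A : κ → Matrix m m ℂ) (U : Matrix m m ℂ) (hU : U ≠ 0)
    (c : ℂ) (h : ∀ ρ : Matrix m m ℂ,
      ∑ k, (w k : ℂ) • (A k * ρ * (A k)ᴴ) = c • (U * ρ * Uᴴ)) (k : κ) :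
    ∃ z : ℂ, A k = z • U := by
  have choi : ∀ i j r s,
      ∑ k, (w k : ℂ) * (A k i j * conj (A k r s)) = c * (U i j * conj (U r s)) := by
    intro i j r s
    have := congrFun (congrFun (h (Matrix.single j s 1)) i) r
    simpa [Matrix.sum_apply, Matrix.mul_apply, Matrix.single_apply, ite_and,
      Finset.sum_ite_eq] using this
  obtain ⟨r, s, hrs⟩ : ∃ r s, U r s ≠ 0 := by
    by_contra! hzero
    exact hU (Matrix.ext hzero)
  refine ⟨A k r s / U r s, Matrix.ext fun i j => ?_⟩
  let f : κ → ℂ := fun k => A k i j * U r s - A k r s * U i j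
  have hsum : ∑ k, (w k : ℂ) * (f k * conj (f k)) = 0 := by
    calc ∑ k, (w k : ℂ) * (f k * conj (f k))
        = U r s * conj (U r s) * ∑ k, (w k : ℂ) * (A k i j * conj (A k i j))
          - U r s * conj (U i j) * ∑ k, (w k : ℂ) * (A k i j * conj (A k r s))
          - U i j * conj (U r s) * ∑ k, (w k : ℂ) * (A k r s * conj (A k i j))
          + U i j * conj (U i j) * ∑ k, (w k : ℂ) * (A k r s * conj (A k r s)) := by
          simp only [Finset.mul_sum, ← Finset.sum_sub_distrib, ← Finset.sum_add_distrib]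
          refine Finset.sum_congr rfl fun k _ => ?_
          simp only [f, map_sub, map_mul]
          ring
      _ = 0 := by
          simp only [choi]
          ring
  have hreal : ∑ k, w k * Complex.normSq (f k) = 0 := by
    have : ((∑ k, w k * Complex.normSq (f k) : ℝ) : ℂ) = 0 := by
      simpa [Complex.mul_conj] using hsum
    exact_mod_cast this
  have hk := (Finset.sum_eq_zero_iff_of_nonneg
    (fun k _ => mul_nonneg (hw k).le (Complex.normSq_nonneg (f k)))).1 hreal k (Finset.mem_univ k)
  have hf : A k i j * U r s - A k r s * U i j = 0 :=
    Complex.normSq_eq_zero.1 ((mul_eq_zero.1 hk).resolve_left (hw k).ne')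
  rw [Matrix.smul_apply, smul_eq_mul, div_mul_eq_mul_div, eq_div_iff hrs]
  exact sub_eq_zero.1 hf

/-- No error filtration for independent random unitaries: if a particle experiences two
independent random unitaries `U₀ ∈ {V, W}` and `U₁ ∈ {S, T}` along two superposed paths,
with at least three of the four unitaries linearly independent, then no choice of control
preparation `(α₀, α₁)` and postselection `(β₀, β₁)` makes the postselected evolution
unitary. -/
theorem no_error_filtration {n : ℕ} (V W S T : Matrix (Fin n) (Fin n) ℂ)
    (hV : V ∈ Matrix.unitaryGroup (Fin n) ℂ) (hW : W ∈ Matrix.unitaryGroup (Fin n) ℂ)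
    (hS : S ∈ Matrix.unitaryGroup (Fin n) ℂ) (hT : T ∈ Matrix.unitaryGroup (Fin n) ℂ)
    (hVWS : LinearIndependent ℂ ![V, W, S]) (hST : LinearIndependent ℂ ![S, T])
    (pV pW qS qT : ℝ) (hpV : 0 < pV) (hpW : 0 < pW) (hqS : 0 < qS) (hqT : 0 < qT)
    (hpsum : pV + pW = 1) (hqsum : qS + qT = 1) :
    ¬ ∃ (α₀ α₁ β₀ β₁ : ℂ) (U : Matrix (Fin n) (Fin n) ℂ) (c : ℝ),
        U ∈ Matrix.unitaryGroup (Fin n) ℂ ∧ 0 < c ∧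
        ∀ ρ : Matrix (Fin n) (Fin n) ℂ,
          ∑ i : Fin 2, ∑ j : Fin 2,
              ((![pV, pW] i * ![qS, qT] j : ℝ) : ℂ) •
                (((α₀ * (starRingEnd ℂ) β₀) • ![V, W] i + (α₁ * (starRingEnd ℂ) β₁) • ![S, T] j)
                  * ρ *
                  ((α₀ * (starRingEnd ℂ) β₀) • ![V, W] i
                    + (α₁ * (starRingEnd ℂ) β₁) • ![S, T] j)ᴴ)
            = (c : ℂ) • (U * ρ * Uᴴ) := by
  rintro ⟨α₀, α₁, β₀, β₁, U, c, hU, hc, h⟩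
  generalize α₀ * (starRingEnd ℂ) β₀ = a at h
  generalize α₁ * (starRingEnd ℂ) β₁ = b at h
  have hU0 : U ≠ 0 := by
    rintro rfl
    have h01 : (0 : Matrix (Fin n) (Fin n) ℂ) = 1 := by
      simpa using Matrix.mem_unitaryGroup_iff.1 hU
    have hS0 : S ≠ 0 := hST.ne_zero 0
    exact hS0 (by rw [← mul_one S, ← h01, mul_zero])
  let A : Fin 2 × Fin 2 → Matrix (Fin n) (Fin n) ℂ :=
    fun k => a • ![V, W] k.1 + b • ![S, T] k.2
  have hkraus : ∀ ρ : Matrix (Fin n) (Fin n) ℂ,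
      ∑ k : Fin 2 × Fin 2, ((![pV, pW] k.1 * ![qS, qT] k.2 : ℝ) : ℂ) • (A k * ρ * (A k)ᴴ)
        = (c : ℂ) • (U * ρ * Uᴴ) := fun ρ => by
    rw [Fintype.sum_prod_type]
    exact h ρ
  have hw : ∀ k : Fin 2 × Fin 2, 0 < ![pV, pW] k.1 * ![qS, qT] k.2 := by
    rintro ⟨i, j⟩
    fin_cases i <;> fin_cases j <;> simp <;> positivity
  have key := exists_eq_smul_of_sum_kraus_eq _ hw A U hU0 c hkraus
  obtain ⟨x, hx⟩ : ∃ x : ℂ, a • V + b • S = x • U := key (0, 0)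
  obtain ⟨y, hy⟩ : ∃ y : ℂ, a • W + b • S = y • U := key (1, 0)
  obtain ⟨z, hz⟩ : ∃ z : ℂ, a • V + b • T = z • U := key (0, 1)
  have hind3 : ∀ r s t : ℂ, r • V + s • W + t • S = 0 → r = 0 ∧ s = 0 ∧ t = 0 := by
    intro r s t hrst
    have := Fintype.linearIndependent_iff.1 hVWS ![r, s, t]
      (by simpa [Fin.sum_univ_three] using hrst)
    exact ⟨this 0, this 1, this 2⟩
  have ha : a = 0 := by
    have hcomb : (y * a) • V + (-(x * a)) • W + (y * b - x * b) • S = 0 := by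
      have : y • (a • V + b • S) - x • (a • W + b • S) = 0 := by
        rw [hx, hy, smul_comm, sub_self]
      rw [← this]
      module
    obtain ⟨-, hxa, -⟩ := hind3 _ _ _ hcomb
    rcases mul_eq_zero.1 (neg_eq_zero.1 hxa) with rfl | ha
    · exact (hind3 a 0 b (by simpa using hx)).1
    · exact ha
  subst ha
  have hb : b = 0 := by
    simp only [zero_smul, zero_add] at hx hz
    have hcomb : (z * b) • S + (-(x * b)) • T = 0 := by
      have : z • (b • S) - x • (b • T) = 0 := by
        rw [hx, hz, smul_comm, sub_self]
      rw [← this]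
      module
    obtain ⟨-, hxb⟩ := LinearIndependent.pair_iff.1 hST _ _ hcomb
    rcases mul_eq_zero.1 (neg_eq_zero.1 hxb) with rfl | hb
    · exact (smul_eq_zero.1 (hx.trans (zero_smul ℂ U))).resolve_right (hST.ne_zero 0)
    · exact hb
  subst hb
  have hone : (c : ℂ) • (1 : Matrix (Fin n) (Fin n) ℂ) = 0 := by
    have h1 : U * Uᴴ = 1 := Matrix.mem_unitaryGroup_iff.1 hU
    simpa [h1] using (h 1).symm
  refine hU0 ?_
  rw [← mul_one U, (smul_eq_zero.1 hone).resolve_left (by exact_mod_cast hc.ne'), mul_zero]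

end
end

section
/- Extremality step of Proposition 1: let A₁, …, A_m be n×n complex matrices, p₁, …, p_m real numbers with p_k > 0 for all k, U an n×n unitary matrix, and c > 0 a real number, such that Σ_k p_k A_k ρ A_k† = c·UρU† for every n×n complex matrix ρ. Then for each k there exists λ_k ∈ ℂ such that A_k = λ_k · U. -/
open Matrix

noncomputable section

open scoped ComplexConjugate in
/-- If a positive combination of the rank-one forms `v k (v k)†` vanishes on a vector supported
on two coordinates, then so does every `v k`. -/
lemma add_mul_eq_zero_of_sum_mul_conj_eq {ι κ : Type*} [Fintype κ] {v : κ → ι → ℂ} {u : ι → ℂ}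
    {p : κ → ℝ} (hp : ∀ k, 0 < p k) {c : ℂ}
    (h : ∀ x y, ∑ k, (p k : ℂ) * (v k x * conj (v k y)) = c * (u x * conj (u y)))
    {x y : ι} {a b : ℂ} (hab : a * u x + b * u y = 0) (k : κ) :
    a * v k x + b * v k y = 0 := by
  have key : ∑ k, (p k : ℂ) * ((a * v k x + b * v k y) * conj (a * v k x + b * v k y)) =
      c * ((a * u x + b * u y) * conj (a * u x + b * u y)) := by
    calc
      _ = a * conj a * ∑ k, (p k : ℂ) * (v k x * conj (v k x))
          + a * conj b * ∑ k, (p k : ℂ) * (v k x * conj (v k y))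
          + b * conj a * ∑ k, (p k : ℂ) * (v k y * conj (v k x))
          + b * conj b * ∑ k, (p k : ℂ) * (v k y * conj (v k y)) := by
        simp only [Finset.mul_sum, ← Finset.sum_add_distrib, map_add, map_mul]
        exact Finset.sum_congr rfl fun _ _ => by ring
      _ = _ := by
        simp only [h, map_add, map_mul]
        ring
  simp only [hab, zero_mul, mul_zero, Complex.mul_conj] at key
  norm_cast at key
  rw [Finset.sum_eq_zero_iff_of_nonneg
    fun j _ => mul_nonneg (hp j).le (Complex.normSq_nonneg _)] at key
  exact Complex.normSq_eq_zero.mp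
    ((mul_eq_zero.mp (key k (Finset.mem_univ k))).resolve_left (hp k).ne')

open scoped ComplexConjugate in
/-- If a positive combination of the rank-one forms `v k (v k)†` is a multiple of `u u†`, then
every `v k` is proportional to `u`. -/
lemma exists_eq_mul_of_sum_mul_conj_eq {ι κ : Type*} [Fintype κ] {v : κ → ι → ℂ} {u : ι → ℂ}
    {p : κ → ℝ} (hp : ∀ k, 0 < p k) {c : ℂ}
    (h : ∀ x y, ∑ k, (p k : ℂ) * (v k x * conj (v k y)) = c * (u x * conj (u y))) (k : κ) :
    ∃ l : ℂ, ∀ x, v k x = l * u x := by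
  by_cases hu : ∃ y, u y ≠ 0
  · obtain ⟨y, hy⟩ := hu
    refine ⟨v k y / u y, fun x => ?_⟩
    have := add_mul_eq_zero_of_sum_mul_conj_eq hp h
      (show u y * u x + -u x * u y = 0 by ring) k
    field_simp
    linear_combination this
  · push Not at hu
    refine ⟨0, fun x => ?_⟩
    simpa using add_mul_eq_zero_of_sum_mul_conj_eq hp h
      (show 1 * u x + 0 * u x = 0 by simp [hu]) k

/-- Extremality step of Proposition 1: if a convex mixture of the maps `ρ ↦ Aₖ ρ Aₖ†`
(with strictly positive weights) equals the unitary evolution `ρ ↦ c · U ρ U†`, then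
every Kraus operator `Aₖ` is proportional to `U`. -/
theorem kraus_of_mixture_unitary {n m : ℕ} (A : Fin m → Matrix (Fin n) (Fin n) ℂ)
    (p : Fin m → ℝ) (hp : ∀ k, 0 < p k) (U : Matrix (Fin n) (Fin n) ℂ)
    (hU : U ∈ Matrix.unitaryGroup (Fin n) ℂ) (c : ℝ) (hc : 0 < c)
    (h : ∀ ρ : Matrix (Fin n) (Fin n) ℂ,
      ∑ k, (p k : ℂ) • (A k * ρ * (A k)ᴴ) = (c : ℂ) • (U * ρ * Uᴴ)) :
    ∀ k, ∃ l : ℂ, A k = l • U := by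
  intro k
  obtain ⟨l, hl⟩ := exists_eq_mul_of_sum_mul_conj_eq (v := fun k x => A k x.1 x.2)
    (u := fun x : Fin n × Fin n => U x.1 x.2) hp (c := (c : ℂ)) (fun x y => by
      simpa [Matrix.sum_apply, Matrix.mul_apply, Matrix.single_apply, ite_and, mul_assoc] using
        congrFun (congrFun (h (Matrix.single x.2 y.2 1)) x.1) y.1) k
  exact ⟨l, Matrix.ext fun i j => hl (i, j)⟩

end
end
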